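/- Let g = 1/138 and δ ∈ (0,1], and let F = (X,Y,A,B,V) be a free game with |X| and |Y| even and ω(F) ≤ 1 − δ/2. Then every ((1−4gδ)/8)-NE of the rescaled game G_s(F,g,δ) has social welfare at most 10/8 − (g/4)·δ. -/

import Mathlib

open Finset

section Bimatrix

variable {I J : Type*} [Fintype I] [Fintype J]

/-- A mixed strategy: a probability distribution on a finite type. -/
def IsDist (x : I → ℝ) : Prop := (∀ i, 0 ≤ x i) ∧ ∑ i, x i = 1

/-- Expected payoff `xᵀ M y`. -/
noncomputable def pay (M : I → J → ℝ) (x : I → ℝ) (y : J → ℝ) : ℝ :=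
  ∑ i, ∑ j, x i * M i j * y j

/-- `(M y)_i`, the payoff of pure row `i` against mixed strategy `y`. -/
noncomputable def rowPay (M : I → J → ℝ) (y : J → ℝ) (i : I) : ℝ := ∑ j, M i j * y j

/-- `(xᵀ M)_j`, the payoff of pure column `j` against mixed strategy `x`. -/
noncomputable def colPay (M : I → J → ℝ) (x : I → ℝ) (j : J) : ℝ := ∑ i, x i * M i j

/-- Social welfare. -/
noncomputable def sw (R C : I → J → ℝ) (x : I → ℝ) (y : J → ℝ) : ℝ := pay R x y + pay C x y

/-- `(x,y)` is an ε-approximate Nash equilibrium of the bimatrix game `(R,C)`. -/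
def IsEpsNE (R C : I → J → ℝ) (x : I → ℝ) (y : J → ℝ) (ε : ℝ) : Prop :=
  IsDist x ∧ IsDist y ∧
  (∀ i, rowPay R y i - pay R x y ≤ ε) ∧
  (∀ j, colPay C x j - pay C x y ≤ ε)

/-- `(x,y)` is an ε-well-supported Nash equilibrium of `(R,C)`. -/
def IsEpsWSNE (R C : I → J → ℝ) (x : I → ℝ) (y : J → ℝ) (ε : ℝ) : Prop :=
  IsDist x ∧ IsDist y ∧
  (∀ i, 0 < x i → ∀ k, rowPay R y k - rowPay R y i ≤ ε) ∧
  (∀ j, 0 < y j → ∀ k, colPay C x k - colPay C x j ≤ ε)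

end Bimatrix

/-- ℓ₁ norm of a finitely-indexed real vector. -/
noncomputable def l1 {I : Type*} [Fintype I] (v : I → ℝ) : ℝ := ∑ i, |v i|

section FreeGame

variable {X Y A B : Type*} [Fintype X] [Fintype Y] [Fintype A] [Fintype B]

/-- Payoff of a strategy pair in the free game with verifier `V`. -/
noncomputable def freePayoff (V : X → Y → A → B → ℝ) (s₁ : X → A) (s₂ : Y → B) : ℝ :=
  (1 / ((Fintype.card X : ℝ) * (Fintype.card Y : ℝ))) * ∑ x, ∑ y, V x y (s₁ x) (s₂ y)

/-- Value `ω(F)` of the free game: the best payoff over all strategy pairs. -/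
noncomputable def gameValue [Nonempty A] [Nonempty B] (V : X → Y → A → B → ℝ) : ℝ :=
  ⨆ s : (X → A) × (Y → B), freePayoff V s.1 s.2

end FreeGame

/-- Functions selecting exactly half of the elements of a finite type. -/
abbrev HalfFns (Y : Type*) [Fintype Y] : Type _ :=
  {f : Y → Bool // 2 * (Finset.univ.filter (fun y => f y = true)).card = Fintype.card Y}

section GGame

variable {X Y A B : Type*} [Fintype X] [Fintype Y] [Fintype A] [Fintype B]

/-- Row player's payoffs in the game `G(F,g,δ)`. -/
noncomputable def GRow (V : X → Y → A → B → ℝ) (g δ : ℝ) :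
    X × A ⊕ HalfFns Y → Y × B ⊕ HalfFns X → ℝ
  | Sum.inl (q, a), Sum.inl (r, b) => V q r a b
  | Sum.inr f, Sum.inl (r, _) => if f.1 r then 4 / (1 + 4 * g * δ) else 0
  | Sum.inl (q, _), Sum.inr f => -(if f.1 q then 4 / (1 + 4 * g * δ) else 0)
  | Sum.inr _, Sum.inr _ => 0

/-- Column player's payoffs in the game `G(F,g,δ)`. -/
noncomputable def GCol (V : X → Y → A → B → ℝ) (g δ : ℝ) :
    X × A ⊕ HalfFns Y → Y × B ⊕ HalfFns X → ℝ
  | Sum.inl (q, a), Sum.inl (r, b) => V q r a b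
  | Sum.inr f, Sum.inl (r, _) => -(if f.1 r then 4 / (1 + 4 * g * δ) else 0)
  | Sum.inl (q, _), Sum.inr f => if f.1 q then 4 / (1 + 4 * g * δ) else 0
  | Sum.inr _, Sum.inr _ => 0

/-- Question marginal of a row-player mixed strategy of `G(F,g,δ)`. -/
noncomputable def rowMarg (x : X × A ⊕ HalfFns Y → ℝ) (q : X) : ℝ := ∑ a, x (Sum.inl (q, a))

/-- Question marginal of a column-player mixed strategy of `G(F,g,δ)`. -/
noncomputable def colMarg (y : Y × B ⊕ HalfFns X → ℝ) (r : Y) : ℝ := ∑ b, y (Sum.inl (r, b))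

/-- Payoff of the two-prover game `T_{(x,y)}` with question distributions `x'`, `y'`. -/
noncomputable def tpPay (V : X → Y → A → B → ℝ) (x' : X → ℝ) (y' : Y → ℝ)
    (s₁ : X → A) (s₂ : Y → B) : ℝ :=
  ∑ q, ∑ r, x' q * y' r * V q r (s₁ q) (s₂ r)

/-- Row payoffs of the rescaled game `G_s(F,g,δ)`. -/
noncomputable def GsRow (V : X → Y → A → B → ℝ) (g δ : ℝ)
    (i : X × A ⊕ HalfFns Y) (j : Y × B ⊕ HalfFns X) : ℝ := (GRow V g δ i j + 4) / 8

/-- Column payoffs of the rescaled game `G_s(F,g,δ)`. -/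
noncomputable def GsCol (V : X → Y → A → B → ℝ) (g δ : ℝ)
    (i : X × A ⊕ HalfFns Y) (j : Y × B ⊕ HalfFns X) : ℝ := (GCol V g δ i j + 4) / 8

/-- Row payoffs of `G'(F)`, extending `G_s` by a new row `𝔦` and a new column `𝔧`
(the `Sum.inr` components); here `ε* = (1 - 4gδ)/8`. -/
noncomputable def G'Row (V : X → Y → A → B → ℝ) (g δ : ℝ) :
    (X × A ⊕ HalfFns Y) ⊕ Unit → (Y × B ⊕ HalfFns X) ⊕ Unit → ℝ
  | Sum.inl i, Sum.inl j => GsRow V g δ i j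
  | Sum.inr _, Sum.inl _ => 5 / 8 + (1 - 4 * g * δ) / 8
  | Sum.inl _, Sum.inr _ => 0
  | Sum.inr _, Sum.inr _ => 1

/-- Column payoffs of `G'(F)`. -/
noncomputable def G'Col (V : X → Y → A → B → ℝ) (g δ : ℝ) :
    (X × A ⊕ HalfFns Y) ⊕ Unit → (Y × B ⊕ HalfFns X) ⊕ Unit → ℝ
  | Sum.inl i, Sum.inl j => GsCol V g δ i j
  | Sum.inr _, Sum.inl _ => 0
  | Sum.inl _, Sum.inr _ => 5 / 8 + (1 - 4 * g * δ) / 8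
  | Sum.inr _, Sum.inr _ => 1

/-- Row payoffs of `G''(F)`, extending `G'` by a new row `𝔦'` and a new column `𝔧'`. -/
noncomputable def G''Row (V : X → Y → A → B → ℝ) (g δ : ℝ) :
    ((X × A ⊕ HalfFns Y) ⊕ Unit) ⊕ Unit → ((Y × B ⊕ HalfFns X) ⊕ Unit) ⊕ Unit → ℝ
  | Sum.inl i, Sum.inl j => G'Row V g δ i j
  | Sum.inr _, Sum.inl _ => 5 / 8
  | Sum.inl _, Sum.inr _ => 5 / 8
  | Sum.inr _, Sum.inr _ => 0

/-- Column payoffs of `G''(F)`. -/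
noncomputable def G''Col (V : X → Y → A → B → ℝ) (g δ : ℝ) :
    ((X × A ⊕ HalfFns Y) ⊕ Unit) ⊕ Unit → ((Y × B ⊕ HalfFns X) ⊕ Unit) ⊕ Unit → ℝ
  | Sum.inl i, Sum.inl j => G'Col V g δ i j
  | Sum.inr _, Sum.inl _ => 5 / 8
  | Sum.inl _, Sum.inr _ => 5 / 8
  | Sum.inr _, Sum.inr _ => 0

end GGame

section ClauseVar

variable {Vars : Type*}

/-- An assignment `α` satisfies a 3-clause `c` (a literal `(v, b)` stands for `v`
if `b = true` and for `¬v` if `b = false`). -/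
def SatClause (α : Vars → Bool) (c : Finset (Vars × Bool)) : Prop :=
  ∃ l ∈ c, α l.1 = l.2

open Classical in
/-- The verifier of the clause–variable free game associated to partitions
`S` of the variables and `T` of the clauses. -/
noncomputable def clauseVarV {m : ℕ} (S : Fin m → Finset Vars)
    (T : Fin m → Finset (Finset (Vars × Bool)))
    (i j : Fin m) (α β : Vars → Bool) : ℝ :=
  if (∀ c ∈ T j, SatClause β c) ∧
      (∀ v ∈ S i, (∃ c ∈ T j, ∃ p : Bool, (v, p) ∈ c) → α v = β v) then 1 else 0

end ClauseVar

section Uniformity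

variable {Y : Type*} [Fintype Y] [DecidableEq Y]

/-- A finite type of even cardinality has a half that collects the largest values of `d`. -/
lemma exists_top_half (hY : Even (Fintype.card Y)) (d : Y → ℝ) :
    ∃ H : Finset Y, 2 * H.card = Fintype.card Y ∧ ∀ i ∈ H, ∀ j ∉ H, d j ≤ d i := by
  obtain ⟨m, hm⟩ := hY
  have hne : (powersetCard m (univ : Finset Y)).Nonempty := by
    rw [powersetCard_nonempty, card_univ]
    omega
  obtain ⟨H, hH, hmax⟩ := exists_max_image _ (fun s : Finset Y => ∑ i ∈ s, d i) hne
  have hc : H.card = m := (mem_powersetCard.1 hH).2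
  refine ⟨H, by omega, fun i hi j hj => ?_⟩
  have hj' : j ∉ H.erase i := fun h => hj (mem_of_mem_erase h)
  have hswap := hmax (insert j (H.erase i)) (mem_powersetCard.2 ⟨subset_univ _, by
    rw [card_insert_of_notMem hj', card_erase_add_one hi, hc]⟩)
  rw [sum_insert hj'] at hswap
  linarith [add_sum_erase H d hi]

/-- If no half of a finite type carries `d`-mass more than `a`, and the total `d`-mass is at
least `-b`, then `d` is small in `ℓ₁`. -/
lemma l1_le_of_half_sums_le [Nonempty Y] (hY : Even (Fintype.card Y)) (d : Y → ℝ) {a b : ℝ}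
    (hb : 0 ≤ b) (hhalf : ∀ H : Finset Y, 2 * H.card = Fintype.card Y → ∑ i ∈ H, d i ≤ a)
    (htot : -b ≤ ∑ i, d i) : l1 d ≤ 4 * a + 3 * b := by
  obtain ⟨H, hH, htop⟩ := exists_top_half hY d
  have hcard : Hᶜ.card = H.card := by
    rw [card_compl]
    omega
  have hne : H.Nonempty := by
    rw [← card_pos]
    have := Fintype.card_pos (α := Y)
    omega
  obtain ⟨k, hk, hmin⟩ := exists_min_image H d hne
  have ha := hhalf H hH
  have hsplit := sum_add_sum_compl H d
  have habs := sum_add_sum_compl H (fun i => |d i|)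
  have hle : ∀ j ∈ Hᶜ, d j ≤ d k := fun j hj => htop k hk j (mem_compl.1 hj)
  have hlow : (H.card : ℝ) * d k ≤ ∑ i ∈ H, d i := by
    simpa using card_nsmul_le_sum H d (d k) hmin
  have hupp : ∑ j ∈ Hᶜ, d j ≤ (H.card : ℝ) * d k := by
    simpa [hcard] using sum_le_card_nsmul Hᶜ d (d k) hle
  unfold l1
  rcases le_total 0 (d k) with h0 | h0
  · have h1 : ∑ i ∈ H, |d i| = ∑ i ∈ H, d i :=
      sum_congr rfl fun i hi => abs_of_nonneg (h0.trans (hmin i hi))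
    have h2 : ∑ j ∈ Hᶜ, |d j| ≤ ∑ j ∈ Hᶜ, (2 * d k - d j) :=
      sum_le_sum fun j hj => abs_le'.2 ⟨by linarith [hle j hj], by linarith⟩
    rw [sum_sub_distrib, sum_const, hcard, nsmul_eq_mul] at h2
    linarith
  · have h1 : ∑ j ∈ Hᶜ, |d j| = -∑ j ∈ Hᶜ, d j := by
      rw [← sum_neg_distrib]
      exact sum_congr rfl fun j hj => abs_of_nonpos ((hle j hj).trans h0)
    have h2 : ∑ i ∈ H, |d i| ≤ ∑ i ∈ H, (d i - 2 * d k) :=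
      sum_le_sum fun i hi => abs_le'.2 ⟨by linarith, by linarith [hmin i hi]⟩
    rw [sum_sub_distrib, sum_const, nsmul_eq_mul] at h2
    linarith

/-- The mass that `p` puts on the half selected by `f`. -/
noncomputable def halfMass (p : Y → ℝ) (f : HalfFns Y) : ℝ := ∑ r, if f.1 r then p r else 0

/-- A nonnegative vector of mass at least `1 - t`, no half of which has mass more than
`1 / 2 + 2 * t`, is close to uniform. -/
lemma l1_sub_uniform_le [Nonempty Y] (hY : Even (Fintype.card Y)) (p : Y → ℝ) {t : ℝ}
    (ht : 0 ≤ t) (hmass : 1 - t ≤ ∑ r, p r) (hhalf : ∀ f, halfMass p f ≤ 1 / 2 + 2 * t) :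
    l1 (fun r => p r - 1 / (Fintype.card Y : ℝ)) ≤ 11 * t := by
  have hn : (0 : ℝ) < Fintype.card Y := by exact_mod_cast Fintype.card_pos
  have h := l1_le_of_half_sums_le hY (fun r => p r - 1 / (Fintype.card Y : ℝ)) (a := 2 * t) ht
    (fun H hH => by
      have h1 := hhalf ⟨fun r => decide (r ∈ H), by simpa using hH⟩
      have h2 : (H.card : ℝ) * (1 / (Fintype.card Y : ℝ)) = 1 / 2 := by
        have : (2 : ℝ) * H.card = Fintype.card Y := by exact_mod_cast hH
        field_simp
        linarith
      rw [sum_sub_distrib, sum_const, nsmul_eq_mul, h2]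
      simp only [halfMass, decide_eq_true_eq, sum_ite_mem, univ_inter] at h1
      linarith)
    (by
      rw [sum_sub_distrib, sum_const, card_univ, nsmul_eq_mul, mul_one_div_cancel hn.ne']
      linarith)
  linarith

end Uniformity

section Strategies

variable {X Y A B : Type*} [Fintype X] [Fintype Y] [Fintype A] [Fintype B]

/-- Conditional on each question, some deterministic answer does at least as well as the
average answer. -/
lemma exists_pure_answers [Nonempty A] (w c : X → A → ℝ) (hw : ∀ q a, 0 ≤ w q a) :
    ∃ s : X → A, ∑ q, ∑ a, w q a * c q a ≤ ∑ q, (∑ a, w q a) * c q (s q) := by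
  choose s hs using fun q => Finite.exists_max (c q)
  refine ⟨s, sum_le_sum fun q _ => ?_⟩
  rw [sum_mul]
  exact sum_le_sum fun a _ => mul_le_mul_of_nonneg_left (hs q a) (hw q a)

/-- Some pair of deterministic strategies does at least as well as randomised answers. -/
lemma exists_tpPay_ge [Nonempty A] [Nonempty B] (V : X → Y → A → B → ℝ)
    (w : X → A → ℝ) (z : Y → B → ℝ) (hw : ∀ q a, 0 ≤ w q a) (hz : ∀ r b, 0 ≤ z r b) :
    ∃ s₁ s₂, ∑ q, ∑ a, ∑ r, ∑ b, w q a * V q r a b * z r b ≤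
      tpPay V (fun q => ∑ a, w q a) (fun r => ∑ b, z r b) s₁ s₂ := by
  obtain ⟨s₁, h₁⟩ := exists_pure_answers w (fun q a => ∑ r, ∑ b, V q r a b * z r b) hw
  obtain ⟨s₂, h₂⟩ :=
    exists_pure_answers z (fun r b => ∑ q, (∑ a, w q a) * V q r (s₁ q) b) hz
  refine ⟨s₁, s₂, ?_⟩
  calc ∑ q, ∑ a, ∑ r, ∑ b, w q a * V q r a b * z r b
      = ∑ q, ∑ a, w q a * ∑ r, ∑ b, V q r a b * z r b := by simp only [mul_sum, mul_assoc]
    _ ≤ ∑ q, (∑ a, w q a) * ∑ r, ∑ b, V q r (s₁ q) b * z r b := h₁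
    _ = ∑ r, ∑ b, z r b * ∑ q, (∑ a, w q a) * V q r (s₁ q) b := by
        simp only [mul_sum (s := univ) (ι := Y), mul_sum (s := univ) (ι := B),
          mul_sum (s := univ) (ι := X)]
        rw [sum_comm]
        refine sum_congr rfl fun r _ => ?_
        rw [sum_comm]
        exact sum_congr rfl fun b _ => sum_congr rfl fun q _ => by ring
    _ ≤ ∑ r, (∑ b, z r b) * ∑ q, (∑ a, w q a) * V q r (s₁ q) (s₂ r) := h₂
    _ = tpPay V (fun q => ∑ a, w q a) (fun r => ∑ b, z r b) s₁ s₂ := by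
        unfold tpPay
        rw [sum_comm]
        refine sum_congr rfl fun r _ => ?_
        rw [mul_sum]
        exact sum_congr rfl fun q _ => by ring

omit [Fintype A] [Fintype B] in
lemma tpPay_le_tpPay_add_l1 (V : X → Y → A → B → ℝ)
    (hV : ∀ q r a b, V q r a b ∈ Set.Icc (0 : ℝ) 1) (p u : X → ℝ) (p' u' : Y → ℝ)
    (hu : ∀ q, 0 ≤ u q) (hp' : ∀ r, 0 ≤ p' r) (s₁ : X → A) (s₂ : Y → B) :
    tpPay V p p' s₁ s₂ ≤ tpPay V u u' s₁ s₂ + l1 (fun q => p q - u q) * ∑ r, p' r +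
      (∑ q, u q) * l1 (fun r => p' r - u' r) := by
  unfold tpPay l1
  simp only [sum_mul_sum, ← sum_add_distrib]
  refine sum_le_sum fun q _ => sum_le_sum fun r _ => ?_
  obtain ⟨h0, h1⟩ := hV q r (s₁ q) (s₂ r)
  have e1 : (p q - u q) * p' r ≤ |p q - u q| * p' r :=
    mul_le_mul_of_nonneg_right (le_abs_self _) (hp' r)
  have e2 : u q * (p' r - u' r) ≤ u q * |p' r - u' r| :=
    mul_le_mul_of_nonneg_left (le_abs_self _) (hu q)
  have e3 := mul_nonneg (abs_nonneg (p q - u q)) (hp' r)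
  have e4 := mul_nonneg (hu q) (abs_nonneg (p' r - u' r))
  have e5 : (|p q - u q| * p' r + u q * |p' r - u' r|) * V q r (s₁ q) (s₂ r) ≤
      |p q - u q| * p' r + u q * |p' r - u' r| :=
    mul_le_of_le_one_right (add_nonneg e3 e4) h1
  have e6 := mul_le_mul_of_nonneg_right (add_le_add e1 e2) h0
  linarith

omit [Fintype A] [Fintype B] in
lemma tpPay_uniform (V : X → Y → A → B → ℝ) (s₁ : X → A) (s₂ : Y → B) :
    tpPay V (fun _ => 1 / (Fintype.card X : ℝ)) (fun _ => 1 / (Fintype.card Y : ℝ)) s₁ s₂ =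
      freePayoff V s₁ s₂ := by
  simp only [tpPay, freePayoff, mul_sum, one_div, mul_inv]

lemma freePayoff_le_gameValue [Nonempty A] [Nonempty B] (V : X → Y → A → B → ℝ)
    (s₁ : X → A) (s₂ : Y → B) : freePayoff V s₁ s₂ ≤ gameValue V :=
  le_ciSup (f := fun s : (X → A) × (Y → B) => freePayoff V s.1 s.2)
    (Set.finite_range _).bddAbove (s₁, s₂)

end Strategies

section Payoffs

variable {I J : Type*} [Fintype I] [Fintype J]

lemma pay_rescale (M : I → J → ℝ) {x : I → ℝ} {y : J → ℝ} (hx : IsDist x) (hy : IsDist y) :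
    pay (fun i j => (M i j + 4) / 8) x y = (pay M x y + 4) / 8 := by
  have h : ∑ i, ∑ j, x i * y j = 1 := by rw [← sum_mul_sum, hx.2, hy.2, one_mul]
  have : pay (fun i j => (M i j + 4) / 8) x y =
      pay M x y / 8 + (∑ i, ∑ j, x i * y j) / 2 := by
    simp only [pay, sum_div, ← sum_add_distrib]
    exact sum_congr rfl fun i _ => sum_congr rfl fun j _ => by ring
  rw [this, h]
  ring

omit [Fintype I] in
lemma rowPay_rescale (M : I → J → ℝ) {y : J → ℝ} (hy : IsDist y) (i : I) :
    rowPay (fun i j => (M i j + 4) / 8) y i = (rowPay M y i + 4) / 8 := by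
  have : rowPay (fun i j => (M i j + 4) / 8) y i = rowPay M y i / 8 + (∑ j, y j) / 2 := by
    simp only [rowPay, sum_div, ← sum_add_distrib]
    exact sum_congr rfl fun j _ => by ring
  rw [this, hy.2]
  ring

omit [Fintype J] in
lemma colPay_rescale (M : I → J → ℝ) {x : I → ℝ} (hx : IsDist x) (j : J) :
    colPay (fun i j => (M i j + 4) / 8) x j = (colPay M x j + 4) / 8 := by
  have : colPay (fun i j => (M i j + 4) / 8) x j = colPay M x j / 8 + (∑ i, x i) / 2 := by
    simp only [colPay, sum_div, ← sum_add_distrib]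
    exact sum_congr rfl fun i _ => by ring
  rw [this, hx.2]
  ring

end Payoffs

section GGame

variable {X Y A B : Type*} [Fintype X] [Fintype Y] [Fintype A] [Fintype B]
  [DecidableEq X] [DecidableEq Y]

/-- The expected verifier payoff when both players ask and answer questions. -/
noncomputable def answerPay (V : X → Y → A → B → ℝ) (x : X × A ⊕ HalfFns Y → ℝ)
    (y : Y × B ⊕ HalfFns X → ℝ) : ℝ :=
  ∑ q, ∑ a, ∑ r, ∑ b, x (Sum.inl (q, a)) * V q r a b * y (Sum.inl (r, b))

/-- The expected mass hit by the row player's half-set guesses. -/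
noncomputable def rowHit (x : X × A ⊕ HalfFns Y → ℝ) (y : Y × B ⊕ HalfFns X → ℝ) : ℝ :=
  ∑ f, x (Sum.inr f) * halfMass (colMarg y) f

/-- The expected mass hit by the column player's half-set guesses. -/
noncomputable def colHit (x : X × A ⊕ HalfFns Y → ℝ) (y : Y × B ⊕ HalfFns X → ℝ) : ℝ :=
  ∑ f, y (Sum.inr f) * halfMass (rowMarg x) f

omit [Fintype A] [DecidableEq Y] in
lemma rowPay_GRow_inr (V : X → Y → A → B → ℝ) (g δ : ℝ) (y : Y × B ⊕ HalfFns X → ℝ)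
    (f : HalfFns Y) :
    rowPay (GRow V g δ) y (Sum.inr f) = 4 / (1 + 4 * g * δ) * halfMass (colMarg y) f := by
  simp only [rowPay, Fintype.sum_sum_type, Fintype.sum_prod_type, GRow, halfMass, colMarg,
    zero_mul, sum_const_zero, add_zero, mul_sum]
  refine sum_congr rfl fun r _ => ?_
  split_ifs <;> simp [mul_sum]

omit [Fintype B] [DecidableEq X] in
lemma colPay_GCol_inr (V : X → Y → A → B → ℝ) (g δ : ℝ) (x : X × A ⊕ HalfFns Y → ℝ)
    (f : HalfFns X) :
    colPay (GCol V g δ) x (Sum.inr f) = 4 / (1 + 4 * g * δ) * halfMass (rowMarg x) f := by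
  simp only [colPay, Fintype.sum_sum_type, Fintype.sum_prod_type, GCol, halfMass, rowMarg,
    mul_zero, sum_const_zero, add_zero, mul_sum]
  refine sum_congr rfl fun q _ => ?_
  split_ifs <;> simp [mul_sum, mul_comm]

omit [Fintype A] [DecidableEq X] in
lemma sum_rowHit (K : ℝ) (x : X × A ⊕ HalfFns Y → ℝ) (y : Y × B ⊕ HalfFns X → ℝ) :
    ∑ f : HalfFns Y, ∑ r, ∑ b, x (Sum.inr f) * (if f.1 r then K else 0) * y (Sum.inl (r, b)) =
      K * rowHit x y := by
  simp only [rowHit, halfMass, colMarg, mul_sum]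
  refine sum_congr rfl fun f _ => sum_congr rfl fun r _ => ?_
  split_ifs
  · simp only [mul_sum]
    exact sum_congr rfl fun b _ => by ring
  · simp

omit [Fintype B] [DecidableEq Y] in
lemma sum_colHit (K : ℝ) (x : X × A ⊕ HalfFns Y → ℝ) (y : Y × B ⊕ HalfFns X → ℝ) :
    ∑ q, ∑ a, ∑ f : HalfFns X, x (Sum.inl (q, a)) * (if f.1 q then K else 0) * y (Sum.inr f) =
      K * colHit x y := by
  simp only [colHit, halfMass, rowMarg, mul_sum]
  rw [sum_comm (s := (univ : Finset (HalfFns X)))]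
  refine sum_congr rfl fun q _ => ?_
  rw [sum_comm]
  refine sum_congr rfl fun f _ => ?_
  split_ifs
  · simp only [mul_sum]
    exact sum_congr rfl fun a _ => by ring
  · simp

lemma pay_GRow (V : X → Y → A → B → ℝ) (g δ : ℝ) (x : X × A ⊕ HalfFns Y → ℝ)
    (y : Y × B ⊕ HalfFns X → ℝ) :
    pay (GRow V g δ) x y =
      answerPay V x y + 4 / (1 + 4 * g * δ) * rowHit x y - 4 / (1 + 4 * g * δ) * colHit x y := by
  rw [← sum_rowHit, ← sum_colHit]
  simp only [pay, answerPay, Fintype.sum_sum_type, Fintype.sum_prod_type, GRow,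
    sum_add_distrib, mul_zero, zero_mul, sum_const_zero, mul_neg, neg_mul, sum_neg_distrib]
  ring

lemma pay_GCol (V : X → Y → A → B → ℝ) (g δ : ℝ) (x : X × A ⊕ HalfFns Y → ℝ)
    (y : Y × B ⊕ HalfFns X → ℝ) :
    pay (GCol V g δ) x y =
      answerPay V x y + 4 / (1 + 4 * g * δ) * colHit x y - 4 / (1 + 4 * g * δ) * rowHit x y := by
  rw [← sum_rowHit, ← sum_colHit]
  simp only [pay, answerPay, Fintype.sum_sum_type, Fintype.sum_prod_type, GCol,
    sum_add_distrib, mul_zero, zero_mul, sum_const_zero, mul_neg, neg_mul, sum_neg_distrib]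
  ring

omit [DecidableEq X] in
lemma IsDist.sum_rowMarg_add {x : X × A ⊕ HalfFns Y → ℝ} (hx : IsDist x) :
    ∑ q, rowMarg x q + ∑ f, x (Sum.inr f) = 1 := by
  simpa only [rowMarg, Fintype.sum_sum_type, Fintype.sum_prod_type] using hx.2

omit [DecidableEq Y] in
lemma IsDist.sum_colMarg_add {y : Y × B ⊕ HalfFns X → ℝ} (hy : IsDist y) :
    ∑ r, colMarg y r + ∑ f, y (Sum.inr f) = 1 := by
  simpa only [colMarg, Fintype.sum_sum_type, Fintype.sum_prod_type] using hy.2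

omit [DecidableEq X] [DecidableEq Y] in
lemma answerPay_le (V : X → Y → A → B → ℝ) (hV : ∀ q r a b, V q r a b ≤ 1)
    {x : X × A ⊕ HalfFns Y → ℝ} {y : Y × B ⊕ HalfFns X → ℝ}
    (hx : ∀ i, 0 ≤ x i) (hy : ∀ j, 0 ≤ y j) :
    answerPay V x y ≤ (∑ q, rowMarg x q) * ∑ r, colMarg y r := by
  calc answerPay V x y
      ≤ ∑ q, ∑ a, ∑ r, ∑ b, x (Sum.inl (q, a)) * y (Sum.inl (r, b)) :=
        sum_le_sum fun q _ => sum_le_sum fun a _ => sum_le_sum fun r _ => sum_le_sum fun b _ =>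
          mul_le_mul_of_nonneg_right (mul_le_of_le_one_right (hx _) (hV q r a b)) (hy _)
    _ = (∑ q, rowMarg x q) * ∑ r, colMarg y r := by
        simp only [rowMarg, colMarg, ← mul_sum, ← sum_mul]

omit [DecidableEq Y] in
lemma halfMass_nonneg {p : Y → ℝ} (hp : ∀ r, 0 ≤ p r) (f : HalfFns Y) : 0 ≤ halfMass p f :=
  sum_nonneg fun r _ => by split_ifs <;> simp [hp r]

omit [DecidableEq Y] in
lemma halfMass_le_sum {p : Y → ℝ} (hp : ∀ r, 0 ≤ p r) (f : HalfFns Y) :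
    halfMass p f ≤ ∑ r, p r :=
  sum_le_sum fun r _ => by split_ifs <;> simp [hp r]

/-- The equilibrium condition against half-set guesses bounds the mass of every half. -/
lemma half_bound_of_deviation {t m P α β : ℝ} (ht : 0 ≤ t) (hP : P ≤ 1) (hα : α ≤ t)
    (hβ : 0 ≤ β)
    (h : 4 / (1 + 4 * t) * m ≤
      P + 4 / (1 + 4 * t) * α - 4 / (1 + 4 * t) * β + (1 - 4 * t)) :
    m ≤ 1 / 2 + 2 * t := by
  have hK : 0 < 1 + 4 * t := by linarith
  have h1 : 4 * m ≤ (P + (1 - 4 * t)) * (1 + 4 * t) + 4 * α - 4 * β := by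
    have := mul_le_mul_of_nonneg_right h hK.le
    have e : ∀ z : ℝ, 4 / (1 + 4 * t) * z * (1 + 4 * t) = 4 * z := fun z => by field_simp
    rw [e, add_mul, sub_mul, add_mul, e, e] at this
    linarith
  nlinarith [mul_nonneg (sub_nonneg.2 hP) hK.le, mul_nonneg ht ht]

end GGame

/-- soundness, rescaled: with `g = 1/138`, if `ω(F) ≤ 1 - δ/2`, then every
`((1-4gδ)/8)`-NE of the rescaled game `G_s(F,g,δ)` has social welfare at most
`10/8 - (g/4)·δ`. -/
theorem soundness_rescaled {X Y A B : Type*}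
    [Fintype X] [Fintype Y] [Fintype A] [Fintype B]
    [DecidableEq X] [DecidableEq Y]
    [Nonempty X] [Nonempty Y] [Nonempty A] [Nonempty B]
    (V : X → Y → A → B → ℝ) (hV : ∀ x y a b, V x y a b = 0 ∨ V x y a b = 1)
    (hX : Even (Fintype.card X)) (hY : Even (Fintype.card Y))
    (g δ : ℝ) (hg : g = 1 / 138) (hδ0 : 0 < δ) (hδ : δ ≤ 1)
    (hω : gameValue V ≤ 1 - δ / 2) :
    ∀ (x : X × A ⊕ HalfFns Y → ℝ) (y : Y × B ⊕ HalfFns X → ℝ),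
      IsEpsNE (GsRow V g δ) (GsCol V g δ) x y ((1 - 4 * g * δ) / 8) →
      sw (GsRow V g δ) (GsCol V g δ) x y ≤ 10 / 8 - (g / 4) * δ := by
  intro x y ⟨hx, hy, hR, hC⟩
  set t := g * δ with ht
  have h4 : 4 * g * δ = 4 * t := by rw [ht]; ring
  have ht0 : 0 < t := by rw [ht, hg]; positivity
  have htδ : 138 * t = δ := by rw [ht, hg]; ring
  have hV01 : ∀ q r a b, V q r a b ∈ Set.Icc (0 : ℝ) 1 := fun q r a b => by
    rcases hV q r a b with h | h <;> simp [h]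
  have epR : pay (GsRow V g δ) x y = (pay (GRow V g δ) x y + 4) / 8 := pay_rescale _ hx hy
  have epC : pay (GsCol V g δ) x y = (pay (GCol V g δ) x y + 4) / 8 := pay_rescale _ hx hy
  have hpR := pay_GRow V g δ x y
  have hpC := pay_GCol V g δ x y
  by_contra! hcon
  have hP : 1 - t < answerPay V x y := by
    rw [sw, epR, epC, hpR, hpC] at hcon
    linarith
  have hx' : ∀ q, 0 ≤ rowMarg x q := fun q => sum_nonneg fun a _ => hx.1 _
  have hy' : ∀ r, 0 ≤ colMarg y r := fun r => sum_nonneg fun b _ => hy.1 _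
  have hxs := hx.sum_rowMarg_add
  have hys := hy.sum_colMarg_add
  have hxf : 0 ≤ ∑ f, x (Sum.inr f) := sum_nonneg fun f _ => hx.1 _
  have hyf : 0 ≤ ∑ f, y (Sum.inr f) := sum_nonneg fun f _ => hy.1 _
  have hx0 : 0 ≤ ∑ q, rowMarg x q := sum_nonneg fun q _ => hx' q
  have hy0 : 0 ≤ ∑ r, colMarg y r := sum_nonneg fun r _ => hy' r
  have hPle := answerPay_le V (fun q r a b => (hV01 q r a b).2) hx.1 hy.1
  have hxm : 1 - t ≤ ∑ q, rowMarg x q := by nlinarith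
  have hym : 1 - t ≤ ∑ r, colMarg y r := by nlinarith
  have hP1 : answerPay V x y ≤ 1 := by nlinarith
  have hα0 : 0 ≤ rowHit x y :=
    sum_nonneg fun f _ => mul_nonneg (hx.1 _) (halfMass_nonneg hy' f)
  have hβ0 : 0 ≤ colHit x y :=
    sum_nonneg fun f _ => mul_nonneg (hy.1 _) (halfMass_nonneg hx' f)
  have hα : rowHit x y ≤ t := by
    have : rowHit x y ≤ ∑ f, x (Sum.inr f) := sum_le_sum fun f _ =>
      mul_le_of_le_one_right (hx.1 _) ((halfMass_le_sum hy' f).trans (by linarith))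
    linarith
  have hβ : colHit x y ≤ t := by
    have : colHit x y ≤ ∑ f, y (Sum.inr f) := sum_le_sum fun f _ =>
      mul_le_of_le_one_right (hy.1 _) ((halfMass_le_sum hx' f).trans (by linarith))
    linarith
  have hyu := l1_sub_uniform_le hY (colMarg y) ht0.le hym fun f => by
    have h1 := hR (Sum.inr f)
    have h2 : rowPay (GsRow V g δ) y (Sum.inr f) = _ := rowPay_rescale _ hy _
    rw [h2, epR, hpR, rowPay_GRow_inr, h4] at h1
    exact half_bound_of_deviation ht0.le hP1 hα hβ0 (by linarith)
  have hxu := l1_sub_uniform_le hX (rowMarg x) ht0.le hxm fun f => by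
    have h1 := hC (Sum.inr f)
    have h2 : colPay (GsCol V g δ) x (Sum.inr f) = _ := colPay_rescale _ hx _
    rw [h2, epC, hpC, colPay_GCol_inr, h4] at h1
    exact half_bound_of_deviation ht0.le hP1 hβ hα0 (by linarith)
  obtain ⟨s₁, s₂, hs⟩ := exists_tpPay_ge V (fun q a => x (Sum.inl (q, a)))
    (fun r b => y (Sum.inl (r, b))) (fun _ _ => hx.1 _) (fun _ _ => hy.1 _)
  have hd := tpPay_le_tpPay_add_l1 V hV01 (rowMarg x) (fun _ => 1 / (Fintype.card X : ℝ))
    (colMarg y) (fun _ => 1 / (Fintype.card Y : ℝ)) (fun _ => by positivity) hy' s₁ s₂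
  rw [tpPay_uniform] at hd
  have hval := (freePayoff_le_gameValue V s₁ s₂).trans hω
  have hs' : answerPay V x y ≤ tpPay V (rowMarg x) (colMarg y) s₁ s₂ := hs
  have hunif : ∑ _q : X, 1 / (Fintype.card X : ℝ) = 1 := by simp
  rw [hunif, one_mul] at hd
  have hmul : l1 (fun q => rowMarg x q - 1 / (Fintype.card X : ℝ)) * ∑ r, colMarg y r ≤
      l1 (fun q => rowMarg x q - 1 / (Fintype.card X : ℝ)) :=
    mul_le_of_le_one_right (sum_nonneg fun _ _ => abs_nonneg _) (by linarith)
  linarith
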